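/- Let H be a complex Hilbert space, let 1 ≤ p < ∞, and let a, b be elements of the Schatten class C_p(H) with singular value sequences (μ_n(a)) and (μ_n(b)), each arranged in decreasing order and repeated according to multiplicity. Then ∑_{n=1}^∞ |μ_n(a) − μ_n(b)|^p ≤ ‖a − b‖_p^p. -/

import Mathlib

/-! Setting: `H` is a complex Hilbert space, and we consider the space `C₁(H)` of trace class
operators on `H` (more generally the Schatten classes `C_p(H)`), regarded as those bounded
operators `a : H →L[ℂ] H` that are compact and whose sequence of singular values is
`p`-summable. The singular values `μₙ(a)` of a compact operator `a` (the eigenvalues of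
`|a| = (a^* a)^(1/2)` arranged in decreasing order and repeated according to multiplicity)
are realized here via the approximation numbers, which coincide with them. -/

/-- `sValue a n` is the `n`-th approximation number (`0`-indexed) of `a`, namely the distance
from `a` to the operators of rank at most `n`.  For a compact operator on a Hilbert space this
coincides with the `(n+1)`-th singular value `μ_{n+1}(a)`, i.e. the `(n+1)`-th eigenvalue of
`|a| = (a^* a)^(1/2)` arranged in decreasing order and repeated according to multiplicity.  In
particular `sValue a 0 = μ₁(a) = ‖a‖`. -/
noncomputable def sValue {H : Type*} [NormedAddCommGroup H] [InnerProductSpace ℂ H]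
    (a : H →L[ℂ] H) (n : ℕ) : ℝ :=
  sInf {r : ℝ | ∃ F : H →L[ℂ] H, LinearMap.rank (F : H →ₗ[ℂ] H) ≤ (n : Cardinal) ∧ r = ‖a - F‖}

/-- Membership in the Schatten class `C_p(H)`: `a` is a compact operator with
`‖a‖_p^p = ∑ₙ μₙ(a)^p < ∞`. -/
def MemSchatten {H : Type*} [NormedAddCommGroup H] [InnerProductSpace ℂ H]
    (p : ℝ) (a : H →L[ℂ] H) : Prop :=
  IsCompactOperator a ∧ Summable (fun n => sValue a n ^ p)

/-- Membership in the trace class `C₁(H)`: `a` is a compact operator with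
`‖a‖₁ = tr |a| = ∑ₙ μₙ(a) < ∞`. -/
def MemTraceClass {H : Type*} [NormedAddCommGroup H] [InnerProductSpace ℂ H]
    (a : H →L[ℂ] H) : Prop :=
  IsCompactOperator a ∧ Summable (fun n => sValue a n)

/-- The trace norm `‖a‖₁ = tr |a| = ∑ₙ μₙ(a)`. -/
noncomputable def traceNorm {H : Type*} [NormedAddCommGroup H] [InnerProductSpace ℂ H]
    (a : H →L[ℂ] H) : ℝ :=
  ∑' n, sValue a n

/-- The closed unit ball of `C₁(H)` with respect to the trace norm `‖·‖₁`. -/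
def traceBall (H : Type*) [NormedAddCommGroup H] [InnerProductSpace ℂ H] :
    Set (H →L[ℂ] H) :=
  {x | MemTraceClass x ∧ traceNorm x ≤ 1}

/-- The λ-function of Aron and Lohman on the closed unit ball of `C₁(H)`:
`λ(a) = sup { t : (e, y, t) ∈ ∂ₑ(B) × B × [0,1] is a triplet amenable to a }`,
where a triplet `(e, y, t)` is amenable to `a` when `a = t • e + (1 - t) • y`. -/
noncomputable def lambdaFn {H : Type*} [NormedAddCommGroup H] [InnerProductSpace ℂ H]
    (a : H →L[ℂ] H) : ℝ :=
  sSup {t : ℝ | t ∈ Set.Icc (0 : ℝ) 1 ∧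
    ∃ e ∈ Set.extremePoints ℝ (traceBall H), ∃ y ∈ traceBall H, a = t • e + (1 - t) • y}

/-- A minimal (i.e. rank-one) partial isometry: `e e^* e = e` and `e` has rank one. -/
def IsMinimalPartialIsometry {H : Type*} [NormedAddCommGroup H] [InnerProductSpace ℂ H]
    [CompleteSpace H] (e : H →L[ℂ] H) : Prop :=
  e ∘L (ContinuousLinearMap.adjoint e) ∘L e = e ∧ LinearMap.rank (e : H →ₗ[ℂ] H) = 1

/-- The rank one operator `η ⊗ ξ : ζ ↦ ⟨ζ, ξ⟩ η` (Mathlib's inner product being conjugate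
linear in the first variable, this is `ζ ↦ ⟪ξ, ζ⟫ • η`). -/
noncomputable def rankOneOp {H : Type*} [NormedAddCommGroup H] [InnerProductSpace ℂ H]
    (η ξ : H) : H →L[ℂ] H :=
  (innerSL ℂ ξ).smulRight η

/-- Courant–Fischer comparison: ordered diagonal quadratic forms have ordered coefficients. -/
theorem coeff_le_of_diagonalForm_le {F ι : Type*} [NormedAddCommGroup F] [InnerProductSpace ℂ F]
    [Fintype ι] [LinearOrder ι] (e f : OrthonormalBasis ι ℂ F) {α β : ι → ℝ}
    (hα : Antitone α) (hβ : Antitone β)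
    (h : ∀ x, ∑ i, α i * ‖inner ℂ (e i) x‖ ^ 2 ≤ ∑ i, β i * ‖inner ℂ (f i) x‖ ^ 2) (i : ι) :
    α i ≤ β i := by
  classical
  have : FiniteDimensional ℂ F := e.toBasis.finiteDimensional_of_finite
  let L : F →ₗ[ℂ] ({j // j ≠ i} → ℂ) := LinearMap.pi fun j =>
    if i < j then (innerSL ℂ (e j) : F →ₗ[ℂ] ℂ) else (innerSL ℂ (f j) : F →ₗ[ℂ] ℂ)
  have hlt : Module.finrank ℂ ({j // j ≠ i} → ℂ) < Module.finrank ℂ F := by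
    rw [Module.finrank_fintype_fun_eq_card, Module.finrank_eq_card_basis e.toBasis]
    exact Fintype.card_subtype_lt (x := i) (by simp)
  obtain ⟨x, hx, hx0⟩ := Submodule.exists_mem_ne_zero_of_ne_bot
    (LinearMap.ker_ne_bot_of_finrank_lt (f := L) hlt)
  have hL : ∀ j (hj : j ≠ i), L x ⟨j, hj⟩ = 0 := fun j hj => by
    rw [LinearMap.mem_ker.mp hx]; rfl
  have he : ∀ j, i < j → inner ℂ (e j) x = 0 := fun j hj => by
    simpa [L, hj] using hL j hj.ne'
  have hf : ∀ j, j < i → inner ℂ (f j) x = 0 := fun j hj => by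
    simpa [L, hj.not_gt] using hL j hj.ne
  have h1 : α i * ‖x‖ ^ 2 ≤ ∑ j, α j * ‖inner ℂ (e j) x‖ ^ 2 := by
    rw [← e.sum_sq_norm_inner_right x, Finset.mul_sum]
    refine Finset.sum_le_sum fun j _ => ?_
    rcases lt_or_ge i j with hj | hj
    · simp [he j hj]
    · exact mul_le_mul_of_nonneg_right (hα hj) (by positivity)
  have h2 : ∑ j, β j * ‖inner ℂ (f j) x‖ ^ 2 ≤ β i * ‖x‖ ^ 2 := by
    rw [← f.sum_sq_norm_inner_right x, Finset.mul_sum]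
    refine Finset.sum_le_sum fun j _ => ?_
    rcases lt_or_ge j i with hj | hj
    · simp [hf j hj]
    · exact mul_le_mul_of_nonneg_right (hβ hj) (by positivity)
  exact le_of_mul_le_mul_right (h1.trans ((h x).trans h2)) (by positivity)

/-- A real combination of orthogonal projections onto the vectors of an orthonormal basis. -/
noncomputable def diagonalOp {F ι : Type*} [NormedAddCommGroup F] [InnerProductSpace ℂ F]
    [Fintype ι] (f : ι → F) (β : ι → ℝ) : F →L[ℂ] F :=
  ∑ i, (β i : ℂ) • InnerProductSpace.rankOne ℂ (f i) (f i)

theorem diagonalOp_isSymmetric {F ι : Type*} [NormedAddCommGroup F] [InnerProductSpace ℂ F]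
    [Fintype ι] (f : ι → F) (β : ι → ℝ) : (diagonalOp f β : F →ₗ[ℂ] F).IsSymmetric := by
  intro x y
  simp only [diagonalOp, ContinuousLinearMap.coe_coe, sum_apply, smul_apply,
    InnerProductSpace.rankOne_apply, sum_inner, inner_sum, inner_smul_left, inner_smul_right,
    Complex.conj_ofReal, inner_conj_symm]
  exact Finset.sum_congr rfl fun i _ => by ring

theorem re_inner_diagonalOp {F ι : Type*} [NormedAddCommGroup F] [InnerProductSpace ℂ F]
    [Fintype ι] (f : ι → F) (β : ι → ℝ) (x : F) :
    (inner ℂ x (diagonalOp f β x)).re = ∑ i, β i * ‖inner ℂ (f i) x‖ ^ 2 := by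
  simp only [diagonalOp, sum_apply, smul_apply,
    InnerProductSpace.rankOne_apply, inner_sum, inner_smul_right, Complex.re_sum]
  refine Finset.sum_congr rfl fun i _ => ?_
  rw [Complex.re_ofReal_mul, ← inner_conj_symm x (f i), Complex.mul_conj, Complex.ofReal_re,
    Complex.normSq_eq_norm_sq]

/-- Ordered spectral theorem for the quadratic form of a symmetric operator. -/
theorem exists_antitone_diagonalForm {F ι : Type*} [NormedAddCommGroup F] [InnerProductSpace ℂ F]
    [Fintype ι] [LinearOrder ι] (e : OrthonormalBasis ι ℂ F) {M : F →ₗ[ℂ] F}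
    (hM : M.IsSymmetric) :
    ∃ (h : OrthonormalBasis ι ℂ F) (μ : ι → ℝ), Antitone μ ∧
      ∀ x, ∑ i, μ i * ‖inner ℂ (h i) x‖ ^ 2 = (inner ℂ x (M x)).re := by
  have : FiniteDimensional ℂ F := e.toBasis.finiteDimensional_of_finite
  let o := Fintype.orderIsoFinOfCardEq ι rfl
  have hn : Module.finrank ℂ F = Fintype.card ι := Module.finrank_eq_card_basis e.toBasis
  let h := (hM.eigenvectorBasis hn).reindex o.toEquiv
  refine ⟨h, fun i => hM.eigenvalues hn (o.symm i), fun i j hij =>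
    hM.eigenvalues_antitone hn (o.symm.monotone hij), fun x => ?_⟩
  rw [← h.sum_inner_mul_inner x (M x), Complex.re_sum]
  refine Finset.sum_congr rfl fun i _ => ?_
  have : M (h i) = (hM.eigenvalues hn (o.symm i) : ℂ) • h i := by
    simp [h, hM.apply_eigenvectorBasis hn (o.symm i)]
  rw [← hM, this, inner_smul_left, Complex.conj_ofReal, ← inner_conj_symm x (h i), mul_left_comm,
    Complex.re_ofReal_mul, mul_comm ((starRingEnd ℂ) _), Complex.mul_conj, Complex.ofReal_re,
    Complex.normSq_eq_norm_sq]

theorem sum_diagonalForm {F ι : Type*} [NormedAddCommGroup F] [InnerProductSpace ℂ F]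
    [Fintype ι] (h f : OrthonormalBasis ι ℂ F) (β : ι → ℝ) :
    ∑ k, ∑ i, β i * ‖inner ℂ (f i) (h k)‖ ^ 2 = ∑ i, β i := by
  rw [Finset.sum_comm]
  refine Finset.sum_congr rfl fun i _ => ?_
  rw [← Finset.mul_sum, h.sum_sq_norm_inner_left, f.norm_eq_one, one_pow, mul_one]

/-- Thresholded Lidskii inequality: if a diagonal form with coefficients `α` is the sum of
diagonal forms with coefficients `β` and `γ`, then `∑ (αᵢ - βᵢ - t)₊ ≤ ∑ (γᵢ - t)₊`. -/
theorem sum_max_sub_le_of_diagonalForm_eq {F ι : Type*} [NormedAddCommGroup F]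
    [InnerProductSpace ℂ F] [Fintype ι] [LinearOrder ι] (e f g : OrthonormalBasis ι ℂ F)
    {α β γ : ι → ℝ} (hα : Antitone α) (hβ : Antitone β)
    (h : ∀ x, ∑ i, α i * ‖inner ℂ (e i) x‖ ^ 2 =
      ∑ i, β i * ‖inner ℂ (f i) x‖ ^ 2 + ∑ i, γ i * ‖inner ℂ (g i) x‖ ^ 2) (t : ℝ) :
    ∑ i, max (α i - β i - t) 0 ≤ ∑ i, max (γ i - t) 0 := by
  obtain ⟨w, μ, hμ, hw⟩ := exists_antitone_diagonalForm e
    ((diagonalOp_isSymmetric f β).add (diagonalOp_isSymmetric g fun i => max (γ i - t) 0))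
  replace hw : ∀ x, ∑ i, μ i * ‖inner ℂ (w i) x‖ ^ 2 = ∑ i, β i * ‖inner ℂ (f i) x‖ ^ 2 +
      ∑ i, max (γ i - t) 0 * ‖inner ℂ (g i) x‖ ^ 2 := fun x => by
    rw [hw, ← re_inner_diagonalOp, ← re_inner_diagonalOp]
    simp
  have hβμ : ∀ i, β i ≤ μ i := coeff_le_of_diagonalForm_le f w hβ hμ fun x => by
    rw [hw]
    exact le_add_of_nonneg_right (Finset.sum_nonneg fun i _ => by positivity)
  have hαμ : ∀ i, α i ≤ μ i + t :=
    coeff_le_of_diagonalForm_le e w hα (fun i j hij => add_le_add_left (hμ hij) t) fun x => by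
      simp only [add_mul, Finset.sum_add_distrib, ← Finset.mul_sum, w.sum_sq_norm_inner_right]
      rw [h, hw, add_assoc]
      refine add_le_add_right ?_ _
      rw [← g.sum_sq_norm_inner_right x, Finset.mul_sum, ← Finset.sum_add_distrib]
      refine Finset.sum_le_sum fun i _ => ?_
      rw [← add_mul]
      exact mul_le_mul_of_nonneg_right (by linarith [le_max_left (γ i - t) 0]) (by positivity)
  have htr : ∑ i, μ i = ∑ i, β i + ∑ i, max (γ i - t) 0 := by
    rw [← sum_diagonalForm w w μ, ← sum_diagonalForm w f β,
      ← sum_diagonalForm w g fun i => max (γ i - t) 0, ← Finset.sum_add_distrib]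
    exact Finset.sum_congr rfl fun k _ => hw (w k)
  calc ∑ i, max (α i - β i - t) 0 ≤ ∑ i, (μ i - β i) :=
        Finset.sum_le_sum fun i _ => max_le (by linarith [hαμ i]) (by linarith [hβμ i])
    _ = _ := by rw [Finset.sum_sub_distrib, htr]; ring

/-- Singular value decomposition in finite dimension. -/
theorem exists_singularValueDecomposition {E : Type*} [NormedAddCommGroup E]
    [InnerProductSpace ℂ E] [FiniteDimensional ℂ E] (T : E →L[ℂ] E) :
    ∃ (u v : OrthonormalBasis (Fin (Module.finrank ℂ E)) ℂ E)
      (σ : Fin (Module.finrank ℂ E) → ℝ), Antitone σ ∧ (∀ i, 0 ≤ σ i) ∧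
      ∀ i, T (v i) = (σ i : ℂ) • u i := by
  have hS := (T : E →ₗ[ℂ] E).isPositive_adjoint_comp_self
  let v := hS.isSymmetric.eigenvectorBasis rfl
  let σ : Fin (Module.finrank ℂ E) → ℝ := fun i => √(hS.isSymmetric.eigenvalues rfl i)
  have hσ0 : ∀ i, 0 ≤ σ i := fun i => Real.sqrt_nonneg _
  have hTT : ∀ i j, inner ℂ (T (v i)) (T (v j)) = if i = j then (σ i : ℂ) ^ 2 else 0 := by
    intro i j
    have h1 : inner ℂ (T (v i)) (T (v j)) =
        inner ℂ (v i) ((LinearMap.adjoint (T : E →ₗ[ℂ] E) ∘ₗ (T : E →ₗ[ℂ] E)) (v j)) := by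
      rw [LinearMap.comp_apply, LinearMap.adjoint_inner_right]; rfl
    rw [h1, hS.isSymmetric.apply_eigenvectorBasis rfl j, inner_smul_right,
      orthonormal_iff_ite.mp v.orthonormal]
    split_ifs with hij
    · subst hij
      have := Real.sq_sqrt (hS.nonneg_eigenvalues rfl i)
      rw [mul_one]
      exact (congrArg Complex.ofReal this.symm).trans (Complex.ofReal_pow _ _)
    · simp
  have hv : Orthonormal ℂ (Set.domRestrict {i | σ i ≠ 0} fun i => ((σ i)⁻¹ : ℂ) • T (v i)) := by
    rw [orthonormal_iff_ite]
    rintro ⟨i, hi⟩ ⟨j, hj⟩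
    have hi' : (σ i : ℂ) ≠ 0 := by exact_mod_cast hi
    change inner ℂ (((σ i)⁻¹ : ℂ) • T (v i)) (((σ j)⁻¹ : ℂ) • T (v j)) = _
    simp only [inner_smul_left, inner_smul_right, hTT, Subtype.mk.injEq]
    split_ifs with hij
    · subst hij
      simp only [map_inv₀, Complex.conj_ofReal]
      field_simp
    · simp
  obtain ⟨u, hu⟩ := hv.exists_orthonormalBasis_extension_of_card_eq (by simp)
  refine ⟨u, v, σ, fun i j hij => Real.sqrt_le_sqrt (hS.isSymmetric.eigenvalues_antitone rfl hij),
    hσ0, fun i => ?_⟩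
  by_cases hi : σ i = 0
  · have := hTT i i
    simp only [hi, if_true] at this
    simpa [hi] using this
  · have hi' : (σ i : ℂ) ≠ 0 := by exact_mod_cast hi
    rw [hu i hi, smul_smul, mul_inv_cancel₀ hi', one_smul]

/-- The orthonormal basis `(uᵢ, ± vᵢ) / √2` of `E × E`. -/
theorem exists_dilationBasis {E ι : Type*} [NormedAddCommGroup E] [InnerProductSpace ℂ E]
    [Fintype ι] (u v : OrthonormalBasis ι ℂ E) :
    ∃ w : OrthonormalBasis (ι ⊕ₗ ιᵒᵈ) ℂ (WithLp 2 (E × E)),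
      (∀ i z, inner ℂ (w (toLex (Sum.inl i))) z =
        (1 / √2 : ℝ) * (inner ℂ (u i) z.ofLp.1 + inner ℂ (v i) z.ofLp.2)) ∧
      (∀ i z, inner ℂ (w (toLex (Sum.inr (OrderDual.toDual i)))) z =
        (1 / √2 : ℝ) * (inner ℂ (u i) z.ofLp.1 - inner ℂ (v i) z.ofLp.2)) := by
  classical
  have : FiniteDimensional ℂ E := u.toBasis.finiteDimensional_of_finite
  obtain ⟨c, hc⟩ : ∃ c : ℂ, c = ((1 / √2 : ℝ) : ℂ) := ⟨_, rfl⟩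
  have hcc : (starRingEnd ℂ) c = c := by rw [hc, Complex.conj_ofReal]
  have hc2 : c * c * 2 = 1 := by
    have : (1 / √2 * (1 / √2) * 2 : ℝ) = 1 := by
      field_simp
      simp
    rw [hc]
    exact_mod_cast this
  obtain ⟨w, hlf, hls, hrf, hrs⟩ : ∃ w : ι ⊕ₗ ιᵒᵈ → WithLp 2 (E × E),
      (∀ i, (w (toLex (Sum.inl i))).ofLp.1 = c • u i) ∧
      (∀ i, (w (toLex (Sum.inl i))).ofLp.2 = c • v i) ∧
      (∀ i, (w (toLex (Sum.inr i))).ofLp.1 = c • u (OrderDual.ofDual i)) ∧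
      (∀ i, (w (toLex (Sum.inr i))).ofLp.2 = -(c • v (OrderDual.ofDual i))) :=
    ⟨fun s => Sum.elim (fun i => WithLp.toLp 2 (c • u i, c • v i))
      (fun i => WithLp.toLp 2 (c • u (OrderDual.ofDual i), -(c • v (OrderDual.ofDual i))))
      (ofLex s), fun _ => rfl, fun _ => rfl, fun _ => rfl, fun _ => rfl⟩
  have how : Orthonormal ℂ w := by
    rw [orthonormal_iff_ite]
    intro s t
    induction s using Lex.rec with | _ s =>
    induction t using Lex.rec with | _ t =>
    rcases s with i | i <;> rcases t with j | j <;>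
    simp only [WithLp.prod_inner_apply, hlf, hls, hrf, hrs, inner_neg_left, inner_neg_right,
      inner_smul_left, inner_smul_right, orthonormal_iff_ite.mp u.orthonormal,
      orthonormal_iff_ite.mp v.orthonormal, hcc, toLex_inj, Sum.inl.injEq, Sum.inr.injEq,
      OrderDual.ofDual_inj, reduceCtorEq, if_false]
    · split_ifs
      · linear_combination hc2
      · ring
    · ring
    · ring
    · split_ifs
      · linear_combination hc2
      · ring
  have hcard : Fintype.card (ι ⊕ₗ ιᵒᵈ) = Module.finrank ℂ (WithLp 2 (E × E)) := by
    rw [(WithLp.linearEquiv 2 ℂ (E × E)).finrank_eq, Module.finrank_prod,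
      Module.finrank_eq_card_basis u.toBasis]
    exact Fintype.card_sum
  refine ⟨OrthonormalBasis.mk how
    (how.linearIndependent.span_eq_top_of_card_eq_finrank' hcard).ge, fun i z => ?_, fun i z => ?_⟩
  · rw [OrthonormalBasis.coe_mk, WithLp.prod_inner_apply, hlf, hls, inner_smul_left,
      inner_smul_left, hcc, ← hc, mul_add]
  · rw [OrthonormalBasis.coe_mk, WithLp.prod_inner_apply, hrf, hrs, OrderDual.ofDual_toDual,
      inner_neg_left, inner_smul_left, inner_smul_left, hcc, ← hc]
    ring

/-- The family `σ` followed by its negatives in reverse order. -/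
def signedDouble {ι : Type*} (σ : ι → ℝ) (s : ι ⊕ₗ ιᵒᵈ) : ℝ :=
  Sum.elim σ (fun i => -σ (OrderDual.ofDual i)) (ofLex s)

theorem signedDouble_antitone {ι : Type*} [LinearOrder ι] {σ : ι → ℝ} (hσ : Antitone σ)
    (h0 : ∀ i, 0 ≤ σ i) : Antitone (signedDouble σ) := by
  intro s t hst
  induction s using Lex.rec with | _ s =>
  induction t using Lex.rec with | _ t =>
  rcases s with i | i <;> rcases t with j | j
  · exact hσ (Sum.Lex.inl_le_inl_iff.mp hst)
  · exact (neg_nonpos.mpr (h0 _)).trans (h0 i)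
  · exact absurd hst Sum.Lex.not_inr_le_inl
  · have hij : i ≤ j := Sum.Lex.inr_le_inr_iff.mp hst
    exact neg_le_neg (hσ (OrderDual.ofDual_le_ofDual.mpr hij))

theorem sum_lex_orderDual {ι : Type*} [Fintype ι] (f : ι ⊕ₗ ιᵒᵈ → ℝ) :
    ∑ s, f s = ∑ i, (f (toLex (Sum.inl i)) + f (toLex (Sum.inr (OrderDual.toDual i)))) := by
  rw [← toLex.sum_comp, Fintype.sum_sum_type, Finset.sum_add_distrib]
  rfl

theorem exists_dilation_diagonalForm {E ι : Type*} [NormedAddCommGroup E] [InnerProductSpace ℂ E]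
    [Fintype ι] (u v : OrthonormalBasis ι ℂ E) {σ : ι → ℝ} {T : E →L[ℂ] E}
    (hT : ∀ i, T (v i) = (σ i : ℂ) • u i) :
    ∃ w : OrthonormalBasis (ι ⊕ₗ ιᵒᵈ) ℂ (WithLp 2 (E × E)), ∀ z,
      ∑ s, signedDouble σ s * ‖inner ℂ (w s) z‖ ^ 2 =
        2 * (inner ℂ z.ofLp.1 (T z.ofLp.2)).re := by
  obtain ⟨w, hl, hr⟩ := exists_dilationBasis u v
  refine ⟨w, fun z => ?_⟩
  have hTz : T z.ofLp.2 = ∑ i, (inner ℂ (v i) z.ofLp.2 * σ i) • u i := by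
    conv_lhs => rw [← v.sum_repr' z.ofLp.2, map_sum]
    simp only [map_smul, hT, smul_smul]
  have hsq : (1 / √2) ^ 2 = (1 / 2 : ℝ) := by simp
  rw [sum_lex_orderDual, hTz, inner_sum, Complex.re_sum, Finset.mul_sum]
  refine Finset.sum_congr rfl fun i _ => ?_
  rw [hl, hr, inner_smul_right, ← inner_conj_symm z.ofLp.1 (u i)]
  generalize inner ℂ (u i) z.ofLp.1 = x
  generalize inner ℂ (v i) z.ofLp.2 = y
  rw [norm_mul, norm_mul, mul_pow, mul_pow, Complex.norm_real, Real.norm_eq_abs, sq_abs, hsq, ← Complex.normSq_eq_norm_sq,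
    ← Complex.normSq_eq_norm_sq, Complex.normSq_apply, Complex.normSq_apply]
  simp [signedDouble]
  ring

/-- Thresholded form of Mirsky's majorization for singular value decompositions. -/
theorem sum_max_abs_sub_le_of_decompositions {E ι : Type*} [NormedAddCommGroup E]
    [InnerProductSpace ℂ E] [Fintype ι] [LinearOrder ι] {S T : E →L[ℂ] E}
    {u₁ v₁ u₂ v₂ u₃ v₃ : OrthonormalBasis ι ℂ E} {σ τ ρ : ι → ℝ}
    (hσ : Antitone σ) (hσ0 : ∀ i, 0 ≤ σ i) (hS : ∀ i, S (v₁ i) = (σ i : ℂ) • u₁ i)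
    (hτ : Antitone τ) (hτ0 : ∀ i, 0 ≤ τ i) (hT : ∀ i, T (v₂ i) = (τ i : ℂ) • u₂ i)
    (hρ0 : ∀ i, 0 ≤ ρ i) (hST : ∀ i, (S - T) (v₃ i) = (ρ i : ℂ) • u₃ i)
    {t : ℝ} (ht : 0 ≤ t) :
    ∑ i, max (|σ i - τ i| - t) 0 ≤ ∑ i, max (ρ i - t) 0 := by
  obtain ⟨e, he⟩ := exists_dilation_diagonalForm u₁ v₁ hS
  obtain ⟨f, hf⟩ := exists_dilation_diagonalForm u₂ v₂ hT
  obtain ⟨g, hg⟩ := exists_dilation_diagonalForm u₃ v₃ hST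
  have h := sum_max_sub_le_of_diagonalForm_eq e f g (signedDouble_antitone hσ hσ0)
    (signedDouble_antitone hτ hτ0) (γ := signedDouble ρ) (fun z => by
      rw [he, hf, hg, sub_apply, inner_sub_right, Complex.sub_re]
      ring) t
  rw [sum_lex_orderDual, sum_lex_orderDual] at h
  refine le_of_eq_of_le (Finset.sum_congr rfl fun i _ => ?_)
    (h.trans_eq (Finset.sum_congr rfl fun i _ => ?_))
  · simp only [signedDouble, ofLex_toLex, Sum.elim_inl, Sum.elim_inr, OrderDual.ofDual_toDual]
    rcases abs_cases (σ i - τ i) with ⟨h1, h2⟩ | ⟨h1, h2⟩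
    · rw [h1, max_eq_right (a := -σ i - -τ i - t) (by linarith), add_zero]
    · rw [h1, max_eq_right (a := σ i - τ i - t) (by linarith), zero_add]
      congr 1
      ring
  · simp only [signedDouble, ofLex_toLex, Sum.elim_inl, Sum.elim_inr, OrderDual.ofDual_toDual]
    rw [max_eq_right (a := -ρ i - t) (by linarith [hρ0 i]), add_zero]

theorem integral_rpow_mul_max_sub {p : ℝ} (hp : 1 < p) {x R : ℝ} (hx : 0 ≤ x) (hxR : x ≤ R) :
    IntervalIntegrable (fun t : ℝ => t ^ (p - 2) * max (x - t) 0) MeasureTheory.volume 0 R ∧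
      ∫ t in (0 : ℝ)..R, t ^ (p - 2) * max (x - t) 0 = x ^ p / (p * (p - 1)) := by
  have hint : ∀ a b : ℝ, IntervalIntegrable (fun t : ℝ => t ^ (p - 2) * max (x - t) 0)
      MeasureTheory.volume a b := fun a b =>
    (intervalIntegral.intervalIntegrable_rpow' (by linarith)).mul_continuousOn (by fun_prop)
  refine ⟨hint 0 R, ?_⟩
  rw [← intervalIntegral.integral_add_adjacent_intervals (hint 0 x) (hint x R)]
  have h2 : ∫ t in x..R, t ^ (p - 2) * max (x - t) 0 = ∫ _ in x..R, (0 : ℝ) := by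
    refine intervalIntegral.integral_congr fun t ht => ?_
    rw [Set.uIcc_of_le hxR] at ht
    simp [max_eq_right (sub_nonpos.mpr ht.1)]
  have h1 : ∫ t in (0 : ℝ)..x, t ^ (p - 2) * max (x - t) 0 =
      ∫ t in (0 : ℝ)..x, (x * t ^ (p - 2) - t ^ (p - 1)) := by
    refine intervalIntegral.integral_congr_ae (Filter.Eventually.of_forall fun t ht => ?_)
    rw [Set.uIoc_of_le hx] at ht
    rw [max_eq_left (sub_nonneg.mpr ht.2), show p - 1 = p - 2 + 1 by ring,
      Real.rpow_add_one ht.1.ne']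
    ring
  rw [h1, h2, intervalIntegral.integral_zero, add_zero, intervalIntegral.integral_sub
    ((intervalIntegral.intervalIntegrable_rpow' (by linarith)).const_mul x)
    (intervalIntegral.intervalIntegrable_rpow' (by linarith)),
    intervalIntegral.integral_const_mul, integral_rpow (.inl (by linarith)),
    integral_rpow (.inl (by linarith)), show p - 2 + 1 = p - 1 by ring, sub_add_cancel,
    Real.zero_rpow (by linarith), Real.zero_rpow (by linarith)]
  have hp1 : p - 1 ≠ 0 := by linarith
  have hp0 : p ≠ 0 := by linarith
  have hxp : x * x ^ (p - 1) = x ^ p := by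
    rcases hx.eq_or_lt with rfl | hx
    · rw [zero_mul, Real.zero_rpow hp0]
    · rw [mul_comm, ← Real.rpow_add_one hx.ne', sub_add_cancel]
  field_simp
  linear_combination p * hxp

/-- Weak majorization, expressed through thresholds, implies domination of `p`-th power sums. -/
theorem sum_rpow_le_of_sum_max_sub_le {ι : Type*} [Fintype ι] {p : ℝ} (hp : 1 ≤ p) {x y : ι → ℝ}
    (hx : ∀ i, 0 ≤ x i) (hy : ∀ i, 0 ≤ y i)
    (h : ∀ t, 0 ≤ t → ∑ i, max (x i - t) 0 ≤ ∑ i, max (y i - t) 0) :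
    ∑ i, x i ^ p ≤ ∑ i, y i ^ p := by
  rcases hp.eq_or_lt with rfl | hp
  · simpa [hx, hy] using h 0 le_rfl
  let R := ∑ i, (x i + y i)
  have hR0 : 0 ≤ R := Finset.sum_nonneg fun i _ => add_nonneg (hx i) (hy i)
  have hR : ∀ i, x i + y i ≤ R := fun i => Finset.single_le_sum (f := fun i => x i + y i)
    (fun i _ => add_nonneg (hx i) (hy i)) (Finset.mem_univ i)
  have hX := fun i => integral_rpow_mul_max_sub hp (hx i) (R := R) (by linarith [hR i, hy i])
  have hY := fun i => integral_rpow_mul_max_sub hp (hy i) (R := R) (by linarith [hR i, hx i])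
  have key : ∑ i, x i ^ p / (p * (p - 1)) ≤ ∑ i, y i ^ p / (p * (p - 1)) := by
    simp only [← (hX _).2, ← (hY _).2]
    rw [← intervalIntegral.integral_finsetSum fun i _ => (hX i).1,
      ← intervalIntegral.integral_finsetSum fun i _ => (hY i).1]
    refine intervalIntegral.integral_mono_on hR0
      (by simpa only [Finset.sum_fn] using IntervalIntegrable.sum Finset.univ fun i _ => (hX i).1)
      (by simpa only [Finset.sum_fn] using IntervalIntegrable.sum Finset.univ fun i _ => (hY i).1)
      fun t ht => ?_
    simp only [← Finset.mul_sum]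
    exact mul_le_mul_of_nonneg_left (h t ht.1) (Real.rpow_nonneg ht.1 _)
  rw [← Finset.sum_div, ← Finset.sum_div] at key
  exact (div_le_div_iff_of_pos_right (mul_pos (by linarith) (by linarith))).mp key

theorem sValue_le_norm_sub {H : Type*} [NormedAddCommGroup H] [InnerProductSpace ℂ H]
    (a : H →L[ℂ] H) {F : H →L[ℂ] H} {n : ℕ} (hF : LinearMap.rank (F : H →ₗ[ℂ] H) ≤ n) :
    sValue a n ≤ ‖a - F‖ :=
  csInf_le ⟨0, by rintro _ ⟨G, -, rfl⟩; exact norm_nonneg _⟩ ⟨F, hF, rfl⟩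

theorem le_sValue {H : Type*} [NormedAddCommGroup H] [InnerProductSpace ℂ H]
    {a : H →L[ℂ] H} {n : ℕ} {r : ℝ}
    (h : ∀ F : H →L[ℂ] H, LinearMap.rank (F : H →ₗ[ℂ] H) ≤ n → r ≤ ‖a - F‖) : r ≤ sValue a n :=
  le_csInf ⟨‖a - 0‖, 0, by simp, rfl⟩ (by rintro _ ⟨F, hF, rfl⟩; exact h F hF)

theorem sValue_nonneg {H : Type*} [NormedAddCommGroup H] [InnerProductSpace ℂ H]
    (a : H →L[ℂ] H) (n : ℕ) : 0 ≤ sValue a n :=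
  le_sValue fun _ _ => norm_nonneg _

theorem exists_norm_sub_lt_sValue_add {H : Type*} [NormedAddCommGroup H] [InnerProductSpace ℂ H]
    (a : H →L[ℂ] H) (n : ℕ) {ε : ℝ} (hε : 0 < ε) :
    ∃ F : H →L[ℂ] H, LinearMap.rank (F : H →ₗ[ℂ] H) ≤ n ∧ ‖a - F‖ < sValue a n + ε := by
  by_contra! h
  linarith [le_sValue h]

theorem sValue_antitone {H : Type*} [NormedAddCommGroup H] [InnerProductSpace ℂ H]
    (a : H →L[ℂ] H) : Antitone (sValue a) := fun _ _ hmn =>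
  le_sValue fun _ hF => sValue_le_norm_sub a (hF.trans (Nat.cast_le.mpr hmn))

theorem sValue_le_add_norm_sub {H : Type*} [NormedAddCommGroup H] [InnerProductSpace ℂ H]
    (a b : H →L[ℂ] H) (n : ℕ) : sValue a n ≤ sValue b n + ‖a - b‖ := by
  rw [← sub_le_iff_le_add]
  refine le_sValue fun F hF => ?_
  linarith [sValue_le_norm_sub a hF, norm_sub_le_norm_sub_add_norm_sub a b F]

theorem sValue_sub_le {H : Type*} [NormedAddCommGroup H] [InnerProductSpace ℂ H]
    (a b : H →L[ℂ] H) (m n : ℕ) : sValue (a - b) (m + n) ≤ sValue a m + sValue b n := by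
  refine le_of_forall_pos_le_add fun ε hε => ?_
  obtain ⟨F, hF, haF⟩ := exists_norm_sub_lt_sValue_add a m (half_pos hε)
  obtain ⟨G, hG, hbG⟩ := exists_norm_sub_lt_sValue_add b n (half_pos hε)
  have hr : LinearMap.rank ((F - G : H →L[ℂ] H) : H →ₗ[ℂ] H) ≤ (m + n : ℕ) := by
    have h1 : ((F - G : H →L[ℂ] H) : H →ₗ[ℂ] H) = F + (-LinearMap.id) ∘ₗ (G : H →ₗ[ℂ] H) := by
      ext x
      simp [sub_eq_add_neg]
    rw [h1, Nat.cast_add]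
    exact (LinearMap.rank_add_le _ _).trans
      (add_le_add hF ((LinearMap.rank_comp_le_right _ _).trans hG))
  have h2 := sValue_le_norm_sub (a - b) hr
  rw [show a - b - (F - G) = (a - F) - (b - G) by abel] at h2
  linarith [norm_sub_le (a - F) (b - G)]

theorem summable_sValue_sub_rpow {H : Type*} [NormedAddCommGroup H] [InnerProductSpace ℂ H]
    {p : ℝ} (hp : 1 ≤ p) {a b : H →L[ℂ] H} (ha : Summable fun n => sValue a n ^ p)
    (hb : Summable fun n => sValue b n ^ p) : Summable fun n => sValue (a - b) n ^ p := by
  have hp0 : 0 ≤ p := by linarith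
  have heven : Summable fun n => sValue (a - b) (2 * n) ^ p := by
    refine .of_nonneg_of_le (fun n => Real.rpow_nonneg (sValue_nonneg _ _) _) (fun n => ?_)
      ((ha.add hb).mul_left (2 ^ (p - 1)))
    rw [two_mul]
    refine (Real.rpow_le_rpow (sValue_nonneg _ _) (sValue_sub_le a b n n) hp0).trans ?_
    have ha0 := sValue_nonneg a n
    have hb0 := sValue_nonneg b n
    generalize sValue a n = x at ha0 ⊢
    generalize sValue b n = y at hb0 ⊢
    lift x to NNReal using ha0
    lift y to NNReal using hb0
    exact_mod_cast NNReal.rpow_add_le_mul_rpow_add_rpow x y hp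
  have hodd : Summable fun n => sValue (a - b) (2 * n + 1) ^ p :=
    .of_nonneg_of_le (fun n => Real.rpow_nonneg (sValue_nonneg _ _) _) (fun n =>
      Real.rpow_le_rpow (sValue_nonneg _ _) (sValue_antitone _ (Nat.le_succ _)) hp0) heven
  exact Summable.even_add_odd heven hodd

theorem sValue_comp_le.{u} {H E : Type u} [NormedAddCommGroup H] [InnerProductSpace ℂ H]
    [NormedAddCommGroup E] [InnerProductSpace ℂ E] (a : H →L[ℂ] H) {A : H →L[ℂ] E} {B : E →L[ℂ] H}
    (hA : ‖A‖ ≤ 1) (hB : ‖B‖ ≤ 1) (n : ℕ) : sValue (A ∘L a ∘L B) n ≤ sValue a n := by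
  refine le_sValue fun F hF => ?_
  have hr : LinearMap.rank ((A ∘L F ∘L B : E →L[ℂ] E) : E →ₗ[ℂ] E) ≤ n :=
    (LinearMap.rank_comp_le_right _ (A : H →ₗ[ℂ] E)).trans
      ((LinearMap.rank_comp_le_left (B : E →ₗ[ℂ] H) _).trans hF)
  refine (sValue_le_norm_sub _ hr).trans ?_
  rw [← ContinuousLinearMap.comp_sub, ← ContinuousLinearMap.sub_comp]
  calc ‖A ∘L (a - F) ∘L B‖ ≤ ‖A‖ * (‖a - F‖ * ‖B‖) :=
        (ContinuousLinearMap.opNorm_comp_le _ _).trans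
          (mul_le_mul_of_nonneg_left (ContinuousLinearMap.opNorm_comp_le _ _) (norm_nonneg _))
    _ ≤ 1 * (‖a - F‖ * 1) := by gcongr
    _ = ‖a - F‖ := by ring

theorem sValue_eq_zero_of_finrank_le {E : Type*} [NormedAddCommGroup E] [InnerProductSpace ℂ E]
    [FiniteDimensional ℂ E] (T : E →L[ℂ] E) {n : ℕ} (hn : Module.finrank ℂ E ≤ n) :
    sValue T n = 0 := by
  refine le_antisymm ((sValue_le_norm_sub T (F := T) ?_).trans_eq (by simp)) (sValue_nonneg _ _)
  refine (LinearMap.rank_le_range _).trans ?_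
  rw [← Module.finrank_eq_rank]
  exact_mod_cast hn

/-- The approximation numbers are the coefficients of a singular value decomposition. -/
theorem sValue_eq_of_decomposition {E : Type*} [NormedAddCommGroup E] [InnerProductSpace ℂ E]
    {d : ℕ} {T : E →L[ℂ] E} (u v : OrthonormalBasis (Fin d) ℂ E)
    {σ : Fin d → ℝ} (hσ : Antitone σ) (hσ0 : ∀ i, 0 ≤ σ i)
    (hT : ∀ i, T (v i) = (σ i : ℂ) • u i) (i : Fin d) : sValue T i = σ i := by
  have : FiniteDimensional ℂ E := u.toBasis.finiteDimensional_of_finite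
  have huT : ∀ j x, inner ℂ (u j) (T x) = σ j * inner ℂ (v j) x := fun j x => by
    conv_lhs => rw [← v.sum_repr' x, map_sum, inner_sum]
    simp only [map_smul, hT, inner_smul_right, orthonormal_iff_ite.mp u.orthonormal]
    simp [mul_comm]
  refine le_antisymm ?_ (le_sValue fun F hF => ?_)
  · let Q : E →L[ℂ] E := ∑ j ∈ Finset.Iio i, InnerProductSpace.rankOne ℂ (v j) (v j)
    have hQ : ∀ k x, inner ℂ (v k) (Q x) = if k < i then inner ℂ (v k) x else 0 := fun k x => by
      simp [Q, sum_apply, orthonormal_iff_ite.mp v.orthonormal]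
    have hrank : LinearMap.rank ((T ∘L Q : E →L[ℂ] E) : E →ₗ[ℂ] E) ≤ (i : ℕ) := by
      refine (LinearMap.rank_comp_le_right (Q : E →ₗ[ℂ] E) (T : E →ₗ[ℂ] E)).trans ?_
      classical
      have hspan : LinearMap.range (Q : E →ₗ[ℂ] E) ≤
          Submodule.span ℂ ((Finset.Iio i).image v : Set E) := by
        rintro _ ⟨x, rfl⟩
        simp only [Q, ContinuousLinearMap.coe_coe, sum_apply, InnerProductSpace.rankOne_apply]
        exact Submodule.sum_mem _ fun j hj => Submodule.smul_mem _ _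
          (Submodule.subset_span (Finset.mem_coe.mpr (Finset.mem_image_of_mem v hj)))
      refine (Submodule.rank_mono hspan).trans ((rank_span_finset_le _).trans ?_)
      exact_mod_cast Finset.card_image_le.trans_eq (Fin.card_Iio i)
    refine (sValue_le_norm_sub T hrank).trans
      (ContinuousLinearMap.opNorm_le_bound _ (hσ0 i) fun x => ?_)
    refine le_of_sq_le_sq ?_ (mul_nonneg (hσ0 i) (norm_nonneg x))
    rw [← u.sum_sq_norm_inner_right, mul_pow, ← v.sum_sq_norm_inner_right x, Finset.mul_sum]
    refine Finset.sum_le_sum fun k _ => ?_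
    rw [sub_apply, ContinuousLinearMap.comp_apply, inner_sub_right, huT, huT, hQ]
    split_ifs with hk
    · rw [sub_self, norm_zero, zero_pow two_ne_zero]
      exact mul_nonneg (sq_nonneg _) (sq_nonneg _)
    · rw [mul_zero, sub_zero, norm_mul, mul_pow, Complex.norm_real, Real.norm_eq_abs, sq_abs]
      have := hσ0 k
      gcongr
      exact hσ (not_lt.mp hk)
  · let L : E →ₗ[ℂ] LinearMap.range (F : E →ₗ[ℂ] E) × ({j // i < j} → ℂ) :=
      (F : E →ₗ[ℂ] E).rangeRestrict.prod (LinearMap.pi fun j => (innerSL ℂ (v j) : E →ₗ[ℂ] ℂ))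
    have hF' : Module.finrank ℂ (LinearMap.range (F : E →ₗ[ℂ] E)) ≤ i :=
      Module.finrank_le_of_rank_le hF
    have hlt : Module.finrank ℂ (LinearMap.range (F : E →ₗ[ℂ] E) × ({j // i < j} → ℂ)) <
        Module.finrank ℂ E := by
      have hc : Fintype.card {j // i < j} = d - 1 - i := by
        rw [Fintype.card_subtype, ← Fin.card_Ioi]
        congr 1
        ext j
        simp
      rw [Module.finrank_prod, Module.finrank_fintype_fun_eq_card, hc,
        Module.finrank_eq_card_basis v.toBasis, Fintype.card_fin]
      have := i.isLt
      omega
    obtain ⟨x, hx, hx0⟩ := Submodule.exists_mem_ne_zero_of_ne_bot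
      (LinearMap.ker_ne_bot_of_finrank_lt (f := L) hlt)
    have hFx : F x = 0 := congrArg (fun y => (y.1 : E)) (LinearMap.mem_ker.mp hx)
    have hvx : ∀ j, i < j → inner ℂ (v j) x = 0 := fun j hj =>
      congrArg (fun y => y.2 ⟨j, hj⟩) (LinearMap.mem_ker.mp hx)
    have h1 : σ i * ‖x‖ ≤ ‖T x‖ := by
      refine le_of_sq_le_sq ?_ (norm_nonneg _)
      rw [← u.sum_sq_norm_inner_right (T x), mul_pow, ← v.sum_sq_norm_inner_right x,
        Finset.mul_sum]
      refine Finset.sum_le_sum fun k _ => ?_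
      rw [huT, norm_mul, mul_pow, Complex.norm_real, Real.norm_eq_abs, sq_abs]
      rcases lt_or_ge i k with hk | hk
      · simp [hvx k hk]
      · have := hσ0 i
        gcongr
        exact hσ hk
    have h2 : ‖T x‖ ≤ ‖T - F‖ * ‖x‖ := by simpa [hFx] using (T - F).le_opNorm x
    exact le_of_mul_le_mul_right (h1.trans h2) (norm_pos_iff.mpr hx0)

theorem sum_range_abs_sValue_sub_rpow_le {E : Type*} [NormedAddCommGroup E]
    [InnerProductSpace ℂ E] [FiniteDimensional ℂ E] {p : ℝ} (hp : 1 ≤ p) (S T : E →L[ℂ] E)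
    (N : ℕ) : ∑ n ∈ Finset.range N, |sValue S n - sValue T n| ^ p ≤
      ∑ n ∈ Finset.range (Module.finrank ℂ E), sValue (S - T) n ^ p := by
  obtain ⟨u₁, v₁, σ, hσ, hσ0, hS⟩ := exists_singularValueDecomposition S
  obtain ⟨u₂, v₂, τ, hτ, hτ0, hT⟩ := exists_singularValueDecomposition T
  obtain ⟨u₃, v₃, ρ, hρ, hρ0, hST⟩ := exists_singularValueDecomposition (S - T)
  have h := sum_rpow_le_of_sum_max_sub_le hp (fun i => abs_nonneg (σ i - τ i)) hρ0
    fun t ht => sum_max_abs_sub_le_of_decompositions hσ hσ0 hS hτ hτ0 hT hρ0 hST ht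
  simp only [← sValue_eq_of_decomposition u₁ v₁ hσ hσ0 hS,
    ← sValue_eq_of_decomposition u₂ v₂ hτ hτ0 hT,
    ← sValue_eq_of_decomposition u₃ v₃ hρ hρ0 hST] at h
  rw [Fin.sum_univ_eq_sum_range (fun n => |sValue S n - sValue T n| ^ p),
    Fin.sum_univ_eq_sum_range (fun n => sValue (S - T) n ^ p)] at h
  refine le_trans ?_ h
  rw [Finset.sum_subset (Finset.range_subset_range.mpr (le_max_right N (Module.finrank ℂ E)))
    fun n _ hn => ?_]
  · exact Finset.sum_le_sum_of_subset_of_nonneg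
      (Finset.range_subset_range.mpr (le_max_left _ _))
      fun n _ _ => Real.rpow_nonneg (abs_nonneg _) _
  · have hn' : Module.finrank ℂ E ≤ n := by simpa using hn
    rw [sValue_eq_zero_of_finrank_le S hn', sValue_eq_zero_of_finrank_le T hn', sub_self,
      abs_zero, Real.zero_rpow (by linarith)]

/-- The compression of an operator to a closed subspace. -/
noncomputable def compression {H : Type*} [NormedAddCommGroup H] [InnerProductSpace ℂ H]
    (E : Submodule ℂ H) [E.HasOrthogonalProjection] (a : H →L[ℂ] H) : E →L[ℂ] E :=
  E.orthogonalProjectionOnto ∘L a ∘L E.subtypeL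

theorem sValue_compression_le {H : Type*} [NormedAddCommGroup H] [InnerProductSpace ℂ H]
    (E : Submodule ℂ H) [E.HasOrthogonalProjection] (a : H →L[ℂ] H) (n : ℕ) :
    sValue (compression E a) n ≤ sValue a n :=
  sValue_comp_le a E.orthogonalProjectionOnto_norm_le E.norm_subtypeL_le n

theorem compression_sub {H : Type*} [NormedAddCommGroup H] [InnerProductSpace ℂ H]
    (E : Submodule ℂ H) [E.HasOrthogonalProjection] (a b : H →L[ℂ] H) :
    compression E (a - b) = compression E a - compression E b := by
  ext x
  simp [compression]

theorem subtypeL_comp_compression_comp_orthogonalProjectionOnto {H : Type*} [NormedAddCommGroup H]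
    [InnerProductSpace ℂ H] [CompleteSpace H] {E : Submodule ℂ H} [E.HasOrthogonalProjection]
    {F : H →L[ℂ] H} (h : ∀ x, F x ∈ E)
    (h' : ∀ x, ContinuousLinearMap.adjoint F (F x) ∈ E) :
    E.subtypeL ∘L compression E F ∘L E.orthogonalProjectionOnto = F := by
  ext x
  have h1 : F (x - E.starProjection x) = 0 := by
    rw [← inner_self_eq_zero (𝕜 := ℂ), ← ContinuousLinearMap.adjoint_inner_left]
    exact Submodule.inner_right_of_mem_orthogonal (h' _)
      (E.sub_starProjection_mem_orthogonal x)
  rw [map_sub, sub_eq_zero] at h1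
  have h2 : E.starProjection (F (E.starProjection x)) = F x := by
    rw [E.starProjection_eq_self_iff.mpr (h _), h1]
  exact h2

theorem abs_sValue_compression_sub_le {H : Type*} [NormedAddCommGroup H] [InnerProductSpace ℂ H]
    [CompleteSpace H] {E : Submodule ℂ H} [E.HasOrthogonalProjection] {a F : H →L[ℂ] H}
    (h : ∀ x, F x ∈ E) (h' : ∀ x, ContinuousLinearMap.adjoint F (F x) ∈ E) (n : ℕ) :
    |sValue (compression E a) n - sValue a n| ≤ 2 * ‖a - F‖ := by
  have hP := E.orthogonalProjectionOnto_norm_le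
  have hι := E.norm_subtypeL_le
  have h1 := sValue_compression_le E a n
  have h2 : sValue (E.subtypeL ∘L compression E a ∘L E.orthogonalProjectionOnto) n ≤
      sValue (compression E a) n := sValue_comp_le _ hι hP n
  have h3 : ‖E.subtypeL ∘L compression E (a - F) ∘L E.orthogonalProjectionOnto‖ ≤ ‖a - F‖ := by
    refine ContinuousLinearMap.opNorm_le_bound _ (norm_nonneg _) fun x => ?_
    calc ‖E.starProjection ((a - F) (E.starProjection x))‖
        ≤ ‖(a - F) (E.starProjection x)‖ := E.norm_starProjection_apply_le _
      _ ≤ ‖a - F‖ * ‖E.starProjection x‖ := (a - F).le_opNorm _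
      _ ≤ ‖a - F‖ * ‖x‖ := by
        gcongr
        exact E.norm_starProjection_apply_le _
  have h4 := sValue_le_add_norm_sub a
    (E.subtypeL ∘L compression E a ∘L E.orthogonalProjectionOnto) n
  have h5 : a - E.subtypeL ∘L compression E a ∘L E.orthogonalProjectionOnto =
      (a - F) - E.subtypeL ∘L compression E (a - F) ∘L E.orthogonalProjectionOnto := by
    rw [compression_sub, ContinuousLinearMap.sub_comp, ContinuousLinearMap.comp_sub,
      subtypeL_comp_compression_comp_orthogonalProjectionOnto h h']
    abel
  rw [h5] at h4
  rw [abs_sub_comm, abs_of_nonneg (by linarith)]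
  linarith [norm_sub_le (a - F)
    (E.subtypeL ∘L compression E (a - F) ∘L E.orthogonalProjectionOnto)]

theorem exists_finiteDimensional_abs_sValue_compression_sub_le {H : Type*}
    [NormedAddCommGroup H] [InnerProductSpace ℂ H] [CompleteSpace H] {p : ℝ} (hp : 0 < p)
    {a : H →L[ℂ] H} (ha : Summable fun n => sValue a n ^ p) {ε : ℝ} (hε : 0 < ε) :
    ∃ K : Submodule ℂ H, FiniteDimensional ℂ K ∧
      ∀ (E : Submodule ℂ H) [E.HasOrthogonalProjection], K ≤ E →
        ∀ n, |sValue (compression E a) n - sValue a n| ≤ ε := by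
  obtain ⟨m, hm⟩ := (ha.tendsto_atTop_zero.eventually_lt_const
    (Real.rpow_pos_of_pos (show 0 < ε / 4 by positivity) p)).exists
  have hm' : sValue a m < ε / 4 :=
    (Real.rpow_lt_rpow_iff (sValue_nonneg _ _) (by positivity) hp).mp hm
  obtain ⟨F, hF, haF⟩ := exists_norm_sub_lt_sValue_add a m (show 0 < ε / 4 by positivity)
  let R := LinearMap.range (F : H →ₗ[ℂ] H)
  have hR : FiniteDimensional ℂ R :=
    Module.rank_lt_aleph0_iff.mp (lt_of_le_of_lt hF (Cardinal.natCast_lt_aleph0))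
  refine ⟨R ⊔ R.map (ContinuousLinearMap.adjoint F : H →ₗ[ℂ] H), inferInstance, fun E _ hE n => ?_⟩
  refine (abs_sValue_compression_sub_le (F := F) (fun x => hE (Submodule.mem_sup_left ⟨x, rfl⟩))
    (fun x => hE (Submodule.mem_sup_right ⟨F x, ⟨x, rfl⟩, rfl⟩)) n).trans ?_
  linarith

theorem exists_abs_sub_sValue_le {H : Type*} [NormedAddCommGroup H] [InnerProductSpace ℂ H]
    [CompleteSpace H] {p : ℝ} (hp : 1 ≤ p) {a b : H →L[ℂ] H}
    (ha : Summable fun n => sValue a n ^ p) (hb : Summable fun n => sValue b n ^ p)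
    {ε : ℝ} (hε : 0 < ε) :
    ∃ x y : ℕ → ℝ, (∀ n, |x n - sValue a n| ≤ ε) ∧ (∀ n, |y n - sValue b n| ≤ ε) ∧
      ∀ N, ∑ n ∈ Finset.range N, |x n - y n| ^ p ≤ ∑' n, sValue (a - b) n ^ p := by
  obtain ⟨K, hK, hKa⟩ :=
    exists_finiteDimensional_abs_sValue_compression_sub_le (by linarith) ha hε
  obtain ⟨L, hL, hLb⟩ :=
    exists_finiteDimensional_abs_sValue_compression_sub_le (by linarith) hb hε
  refine ⟨sValue (compression (K ⊔ L) a), sValue (compression (K ⊔ L) b),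
    hKa _ le_sup_left, hLb _ le_sup_right, fun N => ?_⟩
  refine (sum_range_abs_sValue_sub_rpow_le hp _ _ N).trans ?_
  rw [← compression_sub]
  refine (Finset.sum_le_sum fun n _ => Real.rpow_le_rpow (sValue_nonneg _ _)
    (sValue_compression_le _ _ n) (by linarith)).trans ?_
  exact (summable_sValue_sub_rpow hp ha hb).sum_le_tsum _
    fun n _ => Real.rpow_nonneg (sValue_nonneg _ _) _

/-- (Infinite-dimensional version of Mirsky's inequality.) Let `H` be a
complex Hilbert space, `1 ≤ p < ∞`, and let `a, b ∈ C_p(H)` with singular value sequences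
`(μₙ(a))` and `(μₙ(b))` arranged in decreasing order and repeated according to multiplicity.
Then `∑ₙ |μₙ(a) - μₙ(b)|^p ≤ ‖a - b‖_p^p`. -/
theorem mirsky_inequality_schatten {H : Type*} [NormedAddCommGroup H] [InnerProductSpace ℂ H]
    [CompleteSpace H] (p : ℝ) (hp : 1 ≤ p) (a b : H →L[ℂ] H)
    (ha : MemSchatten p a) (hb : MemSchatten p b) :
    (∑' n, |sValue a n - sValue b n| ^ p) ≤ ∑' n, sValue (a - b) n ^ p := by
  choose x y hx hy hxy using fun k : ℕ =>
    exists_abs_sub_sValue_le hp ha.2 hb.2 (Nat.one_div_pos_of_nat (α := ℝ) (n := k))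
  have hlim : ∀ {z : ℕ → ℕ → ℝ} {c : H →L[ℂ] H},
      (∀ k n, |z k n - sValue c n| ≤ 1 / ((k : ℝ) + 1)) →
      ∀ n, Filter.Tendsto (fun k => z k n) Filter.atTop (nhds (sValue c n)) := fun hz n =>
    tendsto_iff_dist_tendsto_zero.mpr (squeeze_zero (fun _ => dist_nonneg) (fun k => hz k n)
      tendsto_one_div_add_atTop_nhds_zero_nat)
  refine Real.tsum_le_of_sum_range_le (fun n => Real.rpow_nonneg (abs_nonneg _) _) fun N => ?_
  exact le_of_tendsto' (tendsto_finsetSum _ fun n _ =>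
    ((hlim hx n).sub (hlim hy n)).abs.rpow_const (Or.inr (by linarith))) fun k => hxy k N
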